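/- Let k > 0 and L > π/√k. Then there is no locally Lipschitz function ρ : (0,L) → ℝ satisfying ρ'(t) + ρ(t)² ≤ −k for almost every t ∈ (0,L) and lim_{t→0⁺} (ρ(t) − 1/t) = 0. -/

import Mathlib

open Set Filter Topology MeasureTheory

/-- **Analytic core of the Bonnet–Myers theorem and Synge's lemma.** If `k > 0`
and `L > π/√k`, there is no locally Lipschitz function `ρ : (0,L) → ℝ` with
`ρ' + ρ² ≤ -k` almost everywhere on `(0,L)` and `ρ(t) - 1/t → 0` as `t → 0⁺`. -/
theorem no_riccati_subsolution_beyond_pi_div_sqrt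
    (k L : ℝ) (hk : 0 < k) (hL : Real.pi / Real.sqrt k < L) :
    ¬ ∃ ρ : ℝ → ℝ,
      (∀ t ∈ Ioo (0:ℝ) L, ∃ s ∈ 𝓝 t, ∃ K, LipschitzOnWith K ρ s) ∧
      (∀ᵐ t ∂(volume : Measure ℝ), t ∈ Ioo (0:ℝ) L →
        deriv ρ t + (ρ t) ^ 2 ≤ -k) ∧
      Tendsto (fun t => ρ t - 1 / t) (𝓝[>] (0:ℝ)) (𝓝 0) := by
  rintro ⟨ρ, hlip, hric, -⟩
  have hsk : 0 < Real.sqrt k := Real.sqrt_pos.mpr hk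
  have hp : 0 < Real.pi / Real.sqrt k := div_pos Real.pi_pos hsk
  obtain ⟨a, b, ha, hbL, hab⟩ : ∃ a b : ℝ, 0 < a ∧ b < L ∧ Real.pi / Real.sqrt k < b - a :=
    ⟨(L - Real.pi / Real.sqrt k) / 3, L - (L - Real.pi / Real.sqrt k) / 3,
      by linarith, by linarith, by linarith⟩
  have hba : 0 < b - a := hp.trans hab
  have hab' : a < b := by linarith
  obtain ⟨ω, hω⟩ : ∃ ω : ℝ, ω = Real.pi / (b - a) := ⟨_, rfl⟩
  have hω0 : 0 < ω := by rw [hω]; exact div_pos Real.pi_pos hba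
  have hωπ : ω * (b - a) = Real.pi := by rw [hω]; field_simp
  have hωk : ω ^ 2 < k := by
    have h1 : ω < Real.sqrt k := by
      rw [hω, div_lt_iff₀ hba]
      rw [div_lt_iff₀ hsk] at hab
      linarith
    calc ω ^ 2 < Real.sqrt k ^ 2 := by gcongr
      _ = k := Real.sq_sqrt hk.le
  -- the function is Lipschitz on the compact interval
  have hI : ∀ x ∈ Icc a b, x ∈ Ioo (0:ℝ) L := fun x hx => ⟨by linarith [hx.1], by linarith [hx.2]⟩
  have hloc : LocallyLipschitzOn (Icc a b) ρ := by
    intro x hx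
    obtain ⟨s, hs, K, hK⟩ := hlip x (hI x hx)
    exact ⟨K, s, mem_nhdsWithin_of_mem_nhds hs, hK⟩
  obtain ⟨K, hK⟩ := hloc.exists_lipschitzOnWith_of_compact isCompact_Icc
  have hρ : AbsolutelyContinuousOnInterval ρ a b := by
    apply LipschitzOnWith.absolutelyContinuousOnInterval (K := K)
    rwa [uIcc_of_le hab'.le]
  have hφ : AbsolutelyContinuousOnInterval (fun t => Real.sin (ω * (t - a)) ^ 2) a b := by
    apply ContDiffOn.absolutelyContinuousOnInterval
    apply ContDiff.contDiffOn
    fun_prop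
  have hψ : AbsolutelyContinuousOnInterval
      (fun t => Real.sin (ω * (t - a)) * (ω * Real.cos (ω * (t - a)))) a b := by
    apply ContDiffOn.absolutelyContinuousOnInterval
    apply ContDiff.contDiffOn
    fun_prop
  have hG := (hφ.fun_mul hρ).fun_sub hψ
  have hint := hG.integral_deriv_eq_sub
  have hq : Continuous fun t => (k - ω ^ 2) * Real.sin (ω * (t - a)) ^ 2 := by fun_prop
  have hle := intervalIntegral.integral_mono_ae_restrict (μ := volume) hab'.le
    hG.intervalIntegrable_deriv (hq.neg.intervalIntegrable a b) (by
      rw [EventuallyLE, ae_restrict_iff' measurableSet_Icc]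
      filter_upwards [hρ.ae_differentiableAt, hric] with x hx1 hx2 hx
      have hd := (hx1 (by rwa [uIcc_of_le hab'.le])).hasDerivAt
      have hr := hx2 (hI x hx)
      have hl : HasDerivAt (fun t : ℝ => ω * (t - a)) ω x := by
        simpa using ((hasDerivAt_id x).sub_const a).const_mul ω
      have hD := ((hl.sin.fun_pow 2).fun_mul hd).fun_sub (hl.sin.fun_mul (hl.cos.const_mul ω))
      rw [hD.deriv]
      simp only [Nat.cast_ofNat, Pi.neg_apply]
      generalize Real.sin (ω * (x - a)) = s
      generalize Real.cos (ω * (x - a)) = c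
      have h2 := mul_le_mul_of_nonneg_left hr (sq_nonneg s)
      norm_num
      nlinarith [sq_nonneg (s * ρ x - ω * c)])
  have hpos := intervalIntegral.intervalIntegral_pos_of_pos_on (hq.intervalIntegrable a b)
    (fun x hx => by
      have : 0 < Real.sin (ω * (x - a)) := by
        apply Real.sin_pos_of_pos_of_lt_pi
        · exact mul_pos hω0 (by linarith [hx.1])
        · rw [← hωπ]
          exact mul_lt_mul_of_pos_left (by linarith [hx.2]) hω0
      have h2 : 0 < k - ω ^ 2 := by linarith
      positivity) hab'
  rw [hint] at hle
  simp only [hωπ, Pi.neg_apply, intervalIntegral.integral_neg] at hle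
  simp at hle hpos
  linarith
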